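/- arXiv:1704.00185 — 2 statements merged into one kernel-verified Lean document; each statement's English description precedes it below -/
import Mathlib

section
/- Validity of the bilinear (scenario-modulated) Benders optimality cut: let w ∈ {0,1} and suppose y ∈ ℝ^m satisfies the bilinear scenario constraints (E y − d)(1 − w) = 0 (componentwise), (A x + B y − l)(1 − w) ≥ 0 (componentwise), and (‖H y‖ − h·y)(1 − w) ≤ 0. Then for every dual feasible tuple (λ, θ, σ, μ), the bilinear cut (d·λ + (l − A x)·θ)(1 − w) ≤ (g·y)(1 − w) holds. -/
open Matrix

/-- A vector `σ` in the ball of radius `μ` and a vector `v` in the ball of radius `t` satisfy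
`0 ≤ σ ⬝ᵥ v + μ * t`: the second-order cone is contained in its dual cone. -/
theorem dotProduct_add_mul_nonneg_of_sqrt_le {ι : Type*} [Fintype ι] {σ v : ι → ℝ} {μ t : ℝ}
    (hσ : √(∑ i, σ i ^ 2) ≤ μ) (hv : √(∑ i, v i ^ 2) ≤ t) : 0 ≤ σ ⬝ᵥ v + μ * t := by
  have hcs := Real.sum_mul_le_sqrt_mul_sqrt Finset.univ (-σ) v
  have hprod := mul_le_mul hσ hv (Real.sqrt_nonneg _) ((Real.sqrt_nonneg _).trans hσ)
  simp only [Pi.neg_apply, neg_sq, neg_mul, Finset.sum_neg_distrib] at hcs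
  rw [dotProduct]
  linarith

/-- Validity of the bilinear (scenario-modulated) Benders optimality cut:
if `w ∈ {0,1}` and `y` satisfies the bilinear scenario constraints, then for
every dual feasible tuple the bilinear cut holds. -/
theorem bilinear_benders_cut_valid
    {n m p q r : ℕ}
    (A : Matrix (Fin p) (Fin n) ℝ) (B : Matrix (Fin p) (Fin m) ℝ)
    (E : Matrix (Fin q) (Fin m) ℝ) (H : Matrix (Fin r) (Fin m) ℝ)
    (g h : Fin m → ℝ) (d : Fin q → ℝ) (l : Fin p → ℝ) (x : Fin n → ℝ)
    (y : Fin m → ℝ) (w : ℝ) (lam : Fin q → ℝ) (θ : Fin p → ℝ) (σ : Fin r → ℝ) (μ : ℝ)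
    (hw : w = 0 ∨ w = 1)
    -- bilinear scenario constraints
    (hEy : ∀ i, (E.mulVec y i - d i) * (1 - w) = 0)
    (hBy : ∀ i, 0 ≤ (A.mulVec x i + B.mulVec y i - l i) * (1 - w))
    (hcone : (Real.sqrt (∑ i, (H.mulVec y i) ^ 2) - h ⬝ᵥ y) * (1 - w) ≤ 0)
    -- dual feasibility
    (hdual : Eᵀ.mulVec lam + Bᵀ.mulVec θ + Hᵀ.mulVec σ + μ • h = g)
    (hσ : Real.sqrt (∑ i, (σ i) ^ 2) ≤ μ)
    (hθ : ∀ i, 0 ≤ θ i) :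
    (d ⬝ᵥ lam + (l - A.mulVec x) ⬝ᵥ θ) * (1 - w) ≤ (g ⬝ᵥ y) * (1 - w) := by
  rcases hw with rfl | rfl
  · simp only [sub_zero, mul_one] at hEy hBy hcone ⊢
    have hd : E.mulVec y = d := funext fun i => sub_eq_zero.mp (hEy i)
    have hl : (l - A.mulVec x) ⬝ᵥ θ ≤ θ ⬝ᵥ B.mulVec y := by
      rw [dotProduct_comm θ]
      refine dotProduct_le_dotProduct_of_nonneg_right (fun i => ?_) hθ
      rw [Pi.sub_apply]
      linarith [hBy i]
    have hsoc := dotProduct_add_mul_nonneg_of_sqrt_le hσ (sub_nonpos.mp hcone)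
    have hg : g ⬝ᵥ y = lam ⬝ᵥ d + θ ⬝ᵥ B.mulVec y + σ ⬝ᵥ H.mulVec y + μ * (h ⬝ᵥ y) := by
      simp only [← hdual, ← hd, add_dotProduct, smul_dotProduct, mulVec_transpose,
        ← dotProduct_mulVec, smul_eq_mul]
    rw [hg, dotProduct_comm d]
    linarith
  · simp
end

section
/- The Benders master problem is a relaxation of the chance-constrained bilinear model: let K be a finite index set and for each k ∈ K and s ∈ S let (λ^k_s, θ^k_s, σ^k_s, μ^k_s) be dual feasible for scenario s. Let V_MP be the set of values c·x + ρ Σ_s π_s η_s over all (x, w, η) with F x ≤ f, w_s ∈ {0,1}, Σ_s π_s w_s ≤ ε, and (d_s·λ^k_s + (l_s − A x)·θ^k_s)(1 − w_s) ≤ η_s for all k ∈ K, s ∈ S; and let V_CC be the set of values c·x + ρ Σ_s π_s (g_s·y_s)(1 − w_s) over all CC-BL-feasible points (x, (y_s), (w_s)). If ρ ≥ 0, V_CC is nonempty and V_MP is bounded below, then sInf V_MP ≤ sInf V_CC. -/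
open Matrix

/-- Self-duality of the second-order cone: points of two such cones pair nonnegatively. -/
theorem secondOrderCone_pairing_nonneg {ι : Type*} [Fintype ι] {u v : ι → ℝ} {a b : ℝ}
    (hu : Real.sqrt (∑ i, u i ^ 2) ≤ a) (hv : Real.sqrt (∑ i, v i ^ 2) ≤ b) :
    0 ≤ u ⬝ᵥ v + a * b := by
  have hcs := Real.sum_mul_le_sqrt_mul_sqrt Finset.univ (fun i => -u i) v
  simp only [neg_sq, neg_mul, Finset.sum_neg_distrib] at hcs
  have hab := mul_le_mul hu hv (Real.sqrt_nonneg _) ((Real.sqrt_nonneg _).trans hu)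
  simp only [dotProduct]
  linarith

/-- Weak duality for a second-order cone program with equality constraints `E y = d`,
inequality constraints `b ≤ B y` and a conic constraint `‖H y‖ ≤ h ⬝ᵥ y`. -/
theorem secondOrderCone_weak_duality {ιm ιp ιq ιr : Type*} [Fintype ιm] [Fintype ιp]
    [Fintype ιq] [Fintype ιr] {B : Matrix ιp ιm ℝ} {E : Matrix ιq ιm ℝ} {H : Matrix ιr ιm ℝ}
    {g h y : ιm → ℝ} {d lam : ιq → ℝ} {b θ : ιp → ℝ} {σ : ιr → ℝ} {μ : ℝ}
    (hg : Eᵀ *ᵥ lam + Bᵀ *ᵥ θ + Hᵀ *ᵥ σ + μ • h = g)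
    (hσ : Real.sqrt (∑ i, σ i ^ 2) ≤ μ) (hθ : ∀ i, 0 ≤ θ i)
    (hE : E *ᵥ y = d) (hB : ∀ i, b i ≤ (B *ᵥ y) i)
    (hH : Real.sqrt (∑ i, (H *ᵥ y) i ^ 2) ≤ h ⬝ᵥ y) :
    d ⬝ᵥ lam + b ⬝ᵥ θ ≤ g ⬝ᵥ y := by
  have hBθ : b ⬝ᵥ θ ≤ (B *ᵥ y) ⬝ᵥ θ :=
    Finset.sum_le_sum fun i _ => mul_le_mul_of_nonneg_right (hB i) (hθ i)
  have hcone := secondOrderCone_pairing_nonneg hσ hH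
  have hgy : g ⬝ᵥ y = d ⬝ᵥ lam + (B *ᵥ y) ⬝ᵥ θ + (σ ⬝ᵥ (H *ᵥ y) + μ * (h ⬝ᵥ y)) := by
    rw [← hg, ← hE]
    simp only [add_dotProduct, smul_dotProduct, mulVec_transpose, ← dotProduct_mulVec,
      smul_eq_mul]
    rw [dotProduct_comm lam, dotProduct_comm θ]
    ring
  linarith

/-- The Benders master problem `MP-BL`, built from finitely many dual feasible
points for each scenario, is a relaxation of the chance-constrained bilinear
model `CC-BL`: its optimal value is a lower bound on the CC-BL optimal value. -/
theorem benders_master_is_relaxation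
    {S K : Type*} [Fintype S] [Fintype K] {n m p q r t : ℕ}
    (π : S → ℝ) (hπ : ∀ s, 0 ≤ π s) (hπsum : ∑ s, π s = 1)
    (ε ρ : ℝ) (hε : 0 ≤ ε) (hρ : 0 ≤ ρ)
    (F : Matrix (Fin t) (Fin n) ℝ) (f : Fin t → ℝ) (c : Fin n → ℝ)
    (A : Matrix (Fin p) (Fin n) ℝ)
    (B : S → Matrix (Fin p) (Fin m) ℝ) (E : S → Matrix (Fin q) (Fin m) ℝ)
    (H : S → Matrix (Fin r) (Fin m) ℝ)
    (g h : S → Fin m → ℝ) (d : S → Fin q → ℝ) (l : S → Fin p → ℝ)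
    -- the dual points used to build the Benders cuts, one per (k, s)
    (lam : K → S → Fin q → ℝ) (θ : K → S → Fin p → ℝ)
    (σ : K → S → Fin r → ℝ) (μ : K → S → ℝ)
    (hdualfeas : ∀ k s,
      (E s)ᵀ.mulVec (lam k s) + (B s)ᵀ.mulVec (θ k s) + (H s)ᵀ.mulVec (σ k s)
          + μ k s • h s = g s ∧
      Real.sqrt (∑ i, (σ k s i) ^ 2) ≤ μ k s ∧
      ∀ i, 0 ≤ θ k s i)
    -- the set of objective values of the master problem MP-BL
    (VMP : Set ℝ)
    (hVMP : VMP = {v | ∃ (x : Fin n → ℝ) (w : S → ℝ) (η : S → ℝ),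
      (∀ i, F.mulVec x i ≤ f i) ∧
      (∀ s, w s = 0 ∨ w s = 1) ∧
      (∑ s, π s * w s ≤ ε) ∧
      (∀ k s, (d s ⬝ᵥ lam k s + (l s - A.mulVec x) ⬝ᵥ θ k s) * (1 - w s) ≤ η s) ∧
      v = c ⬝ᵥ x + ρ * ∑ s, π s * η s})
    -- the set of objective values of the chance-constrained model CC-BL
    (VCC : Set ℝ)
    (hVCC : VCC = {v | ∃ (x : Fin n → ℝ) (y : S → Fin m → ℝ) (w : S → ℝ),
      (∀ i, F.mulVec x i ≤ f i) ∧
      (∀ s, w s = 0 ∨ w s = 1) ∧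
      (∑ s, π s * w s ≤ ε) ∧
      (∀ s, (∀ i, ((E s).mulVec (y s) i - d s i) * (1 - w s) = 0) ∧
        (∀ i, 0 ≤ (A.mulVec x i + (B s).mulVec (y s) i - l s i) * (1 - w s)) ∧
        (Real.sqrt (∑ i, ((H s).mulVec (y s) i) ^ 2) - h s ⬝ᵥ y s) * (1 - w s) ≤ 0) ∧
      v = c ⬝ᵥ x + ρ * ∑ s, π s * ((g s ⬝ᵥ y s) * (1 - w s))})
    (hne : VCC.Nonempty) (hbdd : BddBelow VMP) :
    sInf VMP ≤ sInf VCC := by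
  refine le_csInf hne fun v hv => csInf_le hbdd ?_
  rw [hVCC] at hv
  obtain ⟨x, y, w, hF, hw, hwε, hfeas, rfl⟩ := hv
  rw [hVMP]
  refine ⟨x, w, fun s => (g s ⬝ᵥ y s) * (1 - w s), hF, hw, hwε, fun k s => ?_, rfl⟩
  rcases hw s with h0 | h1
  · obtain ⟨hE, hB, hH⟩ := hfeas s
    obtain ⟨hg, hσ, hθ⟩ := hdualfeas k s
    simp only [h0, sub_zero, mul_one] at hE hB hH ⊢
    refine secondOrderCone_weak_duality hg hσ hθ (funext fun i => sub_eq_zero.mp (hE i))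
      (fun i => ?_) (sub_nonpos.mp hH)
    have := hB i
    simp only [Pi.sub_apply]
    linarith
  · simp [h1]
end
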